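/- Let I be one of the intervals (τ,σ), (τ,σ], [τ,σ), [τ,σ] with −∞ ≤ τ < σ ≤ ∞. Suppose α(t) ≠ 0 for all t ∈ I and there exists a C¹ solution ρ : I → ℂ of the Riccati equation (R). Suppose the integrals f₁(t) = ∫_t^σ ( e^{∫_t^s Re(ρ(μ) + β(μ)/α(μ)) dμ} / |α(s)| ) ds and f₃(t) = ∫_τ^t e^{∫_s^t Re(ρ(μ)) dμ} ds converge for all t ∈ I, and that sup_{t∈I} f₁(t) < ∞ and sup_{t∈I} f₃(t) < ∞. Then (E) is Ulam stable on I, and L₂ = sup_{t∈I} ∫_τ^t ( ∫_s^σ ( e^{∫_s^μ Re(ρ(ν) + β(ν)/α(ν)) dν} / |α(μ)| ) dμ ) e^{∫_s^t Re(ρ(μ)) dμ} ds is an Ulam constant for (E) on I. -/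

import Mathlib

open MeasureTheory Set

/-- The set of real numbers strictly between `t` and the extended real `σ`. -/
def IooE (t : ℝ) (σ : EReal) : Set ℝ := {s : ℝ | t < s ∧ (s : EReal) < σ}

/-- The set of real numbers strictly between the extended real `τ` and `t`. -/
def EIoo (τ : EReal) (t : ℝ) : Set ℝ := {s : ℝ | τ < (s : EReal) ∧ s < t}

/-- The function `f₁(t) = ∫_t^σ e^{∫_t^s Re(ρ + β/α) dμ} / |α(s)| ds`. -/
noncomputable def f₁ (σ : EReal) (α β ρ : ℝ → ℂ) (t : ℝ) : ℝ :=
  ∫ s in IooE t σ, Real.exp (∫ μ in t..s, (ρ μ + β μ / α μ).re) / ‖α s‖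

/-- The function `f₃(t) = ∫_τ^t e^{∫_s^t Re(ρ) dμ} ds`. -/
noncomputable def f₃ (τ : EReal) (ρ : ℝ → ℂ) (t : ℝ) : ℝ :=
  ∫ s in EIoo τ t, Real.exp (∫ μ in s..t, (ρ μ).re)

/-- `L` is an Ulam constant for `α(t)x'' + β(t)x' + γ(t)x = f(t)` on `I`:
`L > 0` and for every `ε > 0` and every C² function `ξ` with
`sup_{t∈I} ‖α ξ'' + β ξ' + γ ξ - f‖ ≤ ε` there is a solution `x` of the equation on `I`
with `sup_{t∈I} ‖ξ - x‖ ≤ L ε`. -/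
def IsUlamConstant (n : ℕ) (I : Set ℝ) (α β γ : ℝ → ℂ)
    (f : ℝ → EuclideanSpace ℂ (Fin n)) (L : ℝ) : Prop :=
  0 < L ∧ ∀ ε > 0, ∀ ξ ξd ξdd : ℝ → EuclideanSpace ℂ (Fin n),
    (∀ t ∈ I, HasDerivWithinAt ξ (ξd t) I t) →
    (∀ t ∈ I, HasDerivWithinAt ξd (ξdd t) I t) →
    ContinuousOn ξdd I →
    (∀ t ∈ I, ‖α t • ξdd t + β t • ξd t + γ t • ξ t - f t‖ ≤ ε) →
    ∃ x xd xdd : ℝ → EuclideanSpace ℂ (Fin n),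
      (∀ t ∈ I, HasDerivWithinAt x (xd t) I t) ∧
      (∀ t ∈ I, HasDerivWithinAt xd (xdd t) I t) ∧
      ContinuousOn xdd I ∧
      (∀ t ∈ I, α t • xdd t + β t • xd t + γ t • x t = f t) ∧
      ∀ t ∈ I, ‖ξ t - x t‖ ≤ L * ε

section OrdConnected

variable {E : Type*} [NormedAddCommGroup E] {I : Set ℝ}

theorem Set.OrdConnected.exists_Icc_mem_nhdsWithin (hI : I.OrdConnected) {t : ℝ} (ht : t ∈ I) :
    ∃ a b, t ∈ Icc a b ∧ Icc a b ⊆ I ∧ Icc a b ∈ nhdsWithin t I := by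
  have hr : ∃ b ∈ I, t ≤ b ∧ Iic b ∈ nhdsWithin t I := by
    by_cases h : ∃ b ∈ I, t < b
    · obtain ⟨b, hb, htb⟩ := h
      exact ⟨b, hb, htb.le, mem_nhdsWithin_of_mem_nhds (Iic_mem_nhds htb)⟩
    · push Not at h
      exact ⟨t, ht, le_rfl, Filter.mem_of_superset self_mem_nhdsWithin h⟩
  have hl : ∃ a ∈ I, a ≤ t ∧ Ici a ∈ nhdsWithin t I := by
    by_cases h : ∃ a ∈ I, a < t
    · obtain ⟨a, ha, hat⟩ := h
      exact ⟨a, ha, hat.le, mem_nhdsWithin_of_mem_nhds (Ici_mem_nhds hat)⟩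
    · push Not at h
      exact ⟨t, ht, le_rfl, Filter.mem_of_superset self_mem_nhdsWithin h⟩
  obtain ⟨b, hb, htb, hbn⟩ := hr
  obtain ⟨a, ha, hat, han⟩ := hl
  exact ⟨a, b, ⟨hat, htb⟩, hI.out ha hb, Filter.inter_mem han hbn⟩

theorem ContinuousOn.intervalIntegrable_of_ordConnected {g : ℝ → E} (hg : ContinuousOn g I)
    (hI : I.OrdConnected) {a b : ℝ} (ha : a ∈ I) (hb : b ∈ I) :
    IntervalIntegrable g volume a b :=
  (hg.mono (hI.uIcc_subset ha hb)).intervalIntegrable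

theorem integrableOn_indicator_of_inter (hI : I.OrdConnected) {g : ℝ → E} {S : Set ℝ}
    (h : IntegrableOn g (S ∩ I)) : IntegrableOn (I.indicator g) S := by
  rw [IntegrableOn, integrable_indicator_iff hI.measurableSet, IntegrableOn,
    Measure.restrict_restrict hI.measurableSet, inter_comm]
  exact h

variable [NormedSpace ℝ E]

/-- Fundamental theorem of calculus on an arbitrary interval, end points included. -/
theorem ContinuousOn.hasDerivWithinAt_integral [CompleteSpace E] {g : ℝ → E}
    (hg : ContinuousOn g I) (hI : I.OrdConnected) {c t : ℝ} (hc : c ∈ I) (ht : t ∈ I) :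
    HasDerivWithinAt (fun u => ∫ s in c..u, g s) (g t) I t := by
  obtain ⟨a, b, htab, hsub, hmem⟩ := hI.exists_Icc_mem_nhdsWithin ht
  have : Fact (t ∈ Icc a b) := ⟨htab⟩
  have hgab := hg.mono hsub
  have h : HasDerivWithinAt (fun u => ∫ s in c..u, g s) (g t) (Icc a b) t :=
    intervalIntegral.integral_hasDerivWithinAt_right
      (hg.intervalIntegrable_of_ordConnected hI hc ht) (t := Icc a b)
      (hgab.stronglyMeasurableAtFilter_nhdsWithin measurableSet_Icc t) (hgab t htab)
  exact h.mono_of_mem_nhdsWithin hmem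

theorem intervalIntegral_indicator_of_ordConnected (hI : I.OrdConnected) (g : ℝ → E) {a b : ℝ}
    (ha : a ∈ I) (hb : b ∈ I) : ∫ s in a..b, I.indicator g s = ∫ s in a..b, g s :=
  intervalIntegral.integral_congr fun _ hs => indicator_of_mem (hI.uIcc_subset ha hb hs) g

theorem setIntegral_Ioi_inter (hI : I.OrdConnected) {g : ℝ → E}
    (hint : ∀ t ∈ I, IntegrableOn g (Ioi t ∩ I)) {c t : ℝ} (hc : c ∈ I) (ht : t ∈ I) :
    ∫ s in Ioi t ∩ I, g s = (∫ s in Ioi c ∩ I, g s) - ∫ s in c..t, g s := by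
  rw [← setIntegral_indicator hI.measurableSet, ← setIntegral_indicator hI.measurableSet,
    ← intervalIntegral_indicator_of_ordConnected hI g hc ht,
    ← intervalIntegral.integral_Ioi_sub_Ioi'
      (integrableOn_indicator_of_inter hI (hint c hc))
      (integrableOn_indicator_of_inter hI (hint t ht))]
  abel

theorem setIntegral_Iic_inter (hI : I.OrdConnected) {g : ℝ → E}
    (hint : ∀ t ∈ I, IntegrableOn g (Iic t ∩ I)) {c t : ℝ} (hc : c ∈ I) (ht : t ∈ I) :
    ∫ s in Iic t ∩ I, g s = (∫ s in Iic c ∩ I, g s) + ∫ s in c..t, g s := by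
  rw [← setIntegral_indicator hI.measurableSet, ← setIntegral_indicator hI.measurableSet,
    ← intervalIntegral_indicator_of_ordConnected hI g hc ht,
    ← intervalIntegral.integral_Iic_sub_Iic
      (integrableOn_indicator_of_inter hI (hint c hc))
      (integrableOn_indicator_of_inter hI (hint t ht))]
  abel

theorem ContinuousOn.hasDerivWithinAt_setIntegral_Ioi_inter [CompleteSpace E] {g : ℝ → E}
    (hg : ContinuousOn g I) (hI : I.OrdConnected)
    (hint : ∀ t ∈ I, IntegrableOn g (Ioi t ∩ I)) {t : ℝ} (ht : t ∈ I) :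
    HasDerivWithinAt (fun u => ∫ s in Ioi u ∩ I, g s) (-g t) I t :=
  ((hg.hasDerivWithinAt_integral hI ht ht).const_sub _).congr
    (fun _ hu => setIntegral_Ioi_inter hI hint ht hu) (setIntegral_Ioi_inter hI hint ht ht)

theorem ContinuousOn.hasDerivWithinAt_setIntegral_Iic_inter [CompleteSpace E] {g : ℝ → E}
    (hg : ContinuousOn g I) (hI : I.OrdConnected)
    (hint : ∀ t ∈ I, IntegrableOn g (Iic t ∩ I)) {t : ℝ} (ht : t ∈ I) :
    HasDerivWithinAt (fun u => ∫ s in Iic u ∩ I, g s) (g t) I t :=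
  ((hg.hasDerivWithinAt_integral hI ht ht).const_add _).congr
    (fun _ hu => setIntegral_Iic_inter hI hint ht hu) (setIntegral_Iic_inter hI hint ht ht)

theorem ContinuousOn.intervalIntegral_sub_of_ordConnected {p : ℝ → E} (hp : ContinuousOn p I)
    (hI : I.OrdConnected) {c s t : ℝ} (hc : c ∈ I) (hs : s ∈ I) (ht : t ∈ I) :
    ∫ μ in t..s, p μ = (∫ μ in c..s, p μ) - ∫ μ in c..t, p μ :=
  (intervalIntegral.integral_interval_sub_left
    (hp.intervalIntegrable_of_ordConnected hI hc hs)
    (hp.intervalIntegrable_of_ordConnected hI hc ht)).symm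

end OrdConnected

section FirstOrder

variable {E : Type*} [NormedAddCommGroup E] [NormedSpace ℝ E] [NormedSpace ℂ E]
  [IsScalarTower ℝ ℂ E] [CompleteSpace E] {I : Set ℝ}

/-- The solution of `z' = -p z - g` vanishing at the right end of the interval. -/
theorem hasDerivWithinAt_setIntegral_exp_smul_Ioi (hI : I.OrdConnected) {p : ℝ → ℂ} {g : ℝ → E}
    (hp : ContinuousOn p I) (hg : ContinuousOn g I)
    (hint : ∀ t ∈ I, IntegrableOn (fun s => Complex.exp (∫ μ in t..s, p μ) • g s) (Ioi t ∩ I))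
    {t : ℝ} (ht : t ∈ I) :
    HasDerivWithinAt (fun u => ∫ s in Ioi u ∩ I, Complex.exp (∫ μ in u..s, p μ) • g s)
      (-(p t • ∫ s in Ioi t ∩ I, Complex.exp (∫ μ in t..s, p μ) • g s) - g t) I t := by
  set P : ℝ → ℂ := fun u => ∫ μ in t..u, p μ
  have hPd : ∀ u ∈ I, HasDerivWithinAt P (p u) I u := fun u hu =>
    hp.hasDerivWithinAt_integral hI ht hu
  have hker : ∀ u ∈ I, ∀ s ∈ I, Complex.exp (∫ μ in u..s, p μ) • g s =
      Complex.exp (-P u) • Complex.exp (P s) • g s := fun u hu s hs => by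
    rw [hp.intervalIntegral_sub_of_ordConnected hI ht hs hu, smul_smul, ← Complex.exp_add]
    congr 2
    ring
  clear_value P
  have hhc : ContinuousOn (fun s => Complex.exp (P s) • g s) I :=
    (ContinuousOn.cexp fun u hu => (hPd u hu).continuousWithinAt).smul hg
  have hh : ∀ u ∈ I, IntegrableOn (fun s => Complex.exp (P s) • g s) (Ioi u ∩ I) := by
    intro u hu
    refine IntegrableOn.congr_fun ((hint u hu).smul (Complex.exp (P u))) (fun s hs => ?_)
      (measurableSet_Ioi.inter hI.measurableSet)
    simp only [Pi.smul_apply]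
    rw [hker u hu s hs.2, smul_smul, ← Complex.exp_add, add_neg_cancel, Complex.exp_zero, one_smul]
  have hval : ∀ u ∈ I, ∫ s in Ioi u ∩ I, Complex.exp (∫ μ in u..s, p μ) • g s =
      Complex.exp (-P u) • ∫ s in Ioi u ∩ I, Complex.exp (P s) • g s := fun u hu => by
    rw [← integral_smul]
    exact setIntegral_congr_fun (measurableSet_Ioi.inter hI.measurableSet)
      fun s hs => hker u hu s hs.2
  have key := (((hPd t ht).fun_neg).cexp).fun_smul
    (hhc.hasDerivWithinAt_setIntegral_Ioi_inter hI hh ht)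
  refine (key.congr hval (hval t ht)).congr_deriv ?_
  rw [hval t ht, smul_neg, smul_smul (Complex.exp (-P t)), ← Complex.exp_add, neg_add_cancel,
    Complex.exp_zero, one_smul]
  module

/-- The solution of `y' = ρ y + g` vanishing at the left end of the interval. -/
theorem hasDerivWithinAt_setIntegral_exp_smul_Iic (hI : I.OrdConnected) {p : ℝ → ℂ} {g : ℝ → E}
    (hp : ContinuousOn p I) (hg : ContinuousOn g I)
    (hint : ∀ t ∈ I, IntegrableOn (fun s => Complex.exp (∫ μ in s..t, p μ) • g s) (Iic t ∩ I))
    {t : ℝ} (ht : t ∈ I) :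
    HasDerivWithinAt (fun u => ∫ s in Iic u ∩ I, Complex.exp (∫ μ in s..u, p μ) • g s)
      ((p t • ∫ s in Iic t ∩ I, Complex.exp (∫ μ in s..t, p μ) • g s) + g t) I t := by
  set P : ℝ → ℂ := fun u => ∫ μ in t..u, p μ
  have hPd : ∀ u ∈ I, HasDerivWithinAt P (p u) I u := fun u hu =>
    hp.hasDerivWithinAt_integral hI ht hu
  have hker : ∀ u ∈ I, ∀ s ∈ I, Complex.exp (∫ μ in s..u, p μ) • g s =
      Complex.exp (P u) • Complex.exp (-P s) • g s := fun u hu s hs => by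
    rw [hp.intervalIntegral_sub_of_ordConnected hI ht hu hs, smul_smul, ← Complex.exp_add,
      ← sub_eq_add_neg]
  clear_value P
  have hhc : ContinuousOn (fun s => Complex.exp (-P s) • g s) I :=
    (ContinuousOn.cexp (ContinuousOn.neg fun u hu => (hPd u hu).continuousWithinAt)).smul hg
  have hh : ∀ u ∈ I, IntegrableOn (fun s => Complex.exp (-P s) • g s) (Iic u ∩ I) := by
    intro u hu
    refine IntegrableOn.congr_fun ((hint u hu).smul (Complex.exp (-P u))) (fun s hs => ?_)
      (measurableSet_Iic.inter hI.measurableSet)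
    simp only [Pi.smul_apply]
    rw [hker u hu s hs.2, smul_smul, ← Complex.exp_add, neg_add_cancel, Complex.exp_zero, one_smul]
  have hval : ∀ u ∈ I, ∫ s in Iic u ∩ I, Complex.exp (∫ μ in s..u, p μ) • g s =
      Complex.exp (P u) • ∫ s in Iic u ∩ I, Complex.exp (-P s) • g s := fun u hu => by
    rw [← integral_smul]
    exact setIntegral_congr_fun (measurableSet_Iic.inter hI.measurableSet)
      fun s hs => hker u hu s hs.2
  have key := ((hPd t ht).cexp).fun_smul
    (hhc.hasDerivWithinAt_setIntegral_Iic_inter hI hh ht)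
  refine (key.congr hval (hval t ht)).congr_deriv ?_
  rw [hval t ht, smul_smul (Complex.exp (P t)), ← Complex.exp_add, add_neg_cancel,
    Complex.exp_zero, one_smul]
  module

theorem ContinuousOn.norm_cexp_intervalIntegral (hI : I.OrdConnected) {p : ℝ → ℂ}
    (hp : ContinuousOn p I) {a b : ℝ} (ha : a ∈ I) (hb : b ∈ I) :
    ‖Complex.exp (∫ μ in a..b, p μ)‖ = Real.exp (∫ μ in a..b, (p μ).re) := by
  rw [Complex.norm_exp]
  congr 1
  exact (intervalIntegral.intervalIntegral_re
    (hp.intervalIntegrable_of_ordConnected hI ha hb)).symm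

theorem ContinuousOn.intervalIntegral_right (hI : I.OrdConnected) {p : ℝ → ℂ}
    (hp : ContinuousOn p I) {c : ℝ} (hc : c ∈ I) : ContinuousOn (fun s => ∫ μ in c..s, p μ) I :=
  fun _ hu => (hp.hasDerivWithinAt_integral hI hc hu).continuousWithinAt

theorem ContinuousOn.intervalIntegral_left (hI : I.OrdConnected) {p : ℝ → ℂ}
    (hp : ContinuousOn p I) {c : ℝ} (hc : c ∈ I) : ContinuousOn (fun s => ∫ μ in s..c, p μ) I := by
  simp_rw [fun s => intervalIntegral.integral_symm (μ := volume) (f := p) c s]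
  exact (hp.intervalIntegral_right hI hc).neg

end FirstOrder

section Ulam

theorem volume_Ioi_inter_interior_pos {I : Set ℝ} {t : ℝ} (ht : t ∈ interior I) :
    0 < volume (Ioi t ∩ interior I) := by
  obtain ⟨l, u, ⟨_, htu⟩, h⟩ := mem_nhds_iff_exists_Ioo_subset.1 (isOpen_interior.mem_nhds ht)
  refine lt_of_lt_of_le ?_ (measure_mono (s := Ioo t u) fun s hs => ⟨hs.1, h ⟨by grind, hs.2⟩⟩)
  simpa using htu

theorem volume_Iic_inter_interior_pos {I : Set ℝ} {t : ℝ} (ht : t ∈ interior I) :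
    0 < volume (Iic t ∩ interior I) := by
  obtain ⟨l, u, ⟨hlt, _⟩, h⟩ := mem_nhds_iff_exists_Ioo_subset.1 (isOpen_interior.mem_nhds ht)
  refine lt_of_lt_of_le ?_ (measure_mono (s := Ioo l t) fun s hs => ⟨hs.2.le, h ⟨hs.1, by grind⟩⟩)
  simpa using hlt

theorem continuousOn_setIntegral_exp_div_norm {I : Set ℝ} (hI : I.OrdConnected) {p α : ℝ → ℂ}
    (hp : ContinuousOn p I) (hα : ContinuousOn α I) (hα0 : ∀ t ∈ I, α t ≠ 0)
    (hint : ∀ t ∈ I, IntegrableOn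
      (fun s => Real.exp (∫ μ in t..s, (p μ).re) / ‖α s‖) (Ioi t ∩ I)) :
    ContinuousOn
      (fun t => ∫ s in Ioi t ∩ I, Real.exp (∫ μ in t..s, (p μ).re) / ‖α s‖) I := by
  have hker : ∀ t s : ℝ,
      Complex.exp (∫ μ in t..s, ((p μ).re : ℂ)) • ((‖α s‖⁻¹ : ℝ) : ℂ) =
        ((Real.exp (∫ μ in t..s, (p μ).re) / ‖α s‖ : ℝ) : ℂ) := fun t s => by
    rw [intervalIntegral.integral_ofReal, smul_eq_mul, div_eq_mul_inv]
    push_cast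
    rfl
  have hpre : ContinuousOn (fun s => ((p s).re : ℂ)) I :=
    Complex.continuous_ofReal.comp_continuousOn (Complex.continuous_re.comp_continuousOn hp)
  have hαinv : ContinuousOn (fun s => ((‖α s‖⁻¹ : ℝ) : ℂ)) I :=
    Complex.continuous_ofReal.comp_continuousOn
      (hα.norm.inv₀ fun t ht => norm_ne_zero_iff.2 (hα0 t ht))
  have h := fun t (ht : t ∈ I) => hasDerivWithinAt_setIntegral_exp_smul_Ioi hI hpre hαinv
    (fun t ht => by simp_rw [hker]; exact (hint t ht).ofReal) ht
  have hc : ContinuousOn (fun t => ∫ s in Ioi t ∩ I,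
      ((Real.exp (∫ μ in t..s, (p μ).re) / ‖α s‖ : ℝ) : ℂ)) I := by
    simp_rw [← hker]
    exact fun t ht => (h t ht).continuousWithinAt
  refine (Complex.continuous_re.comp_continuousOn hc).congr fun t _ => ?_
  simp only [Function.comp_apply]
  rw [integral_complex_ofReal]
  exact (Complex.ofReal_re _).symm

theorem isUlamConstant_of_riccati (n : ℕ) {I : Set ℝ} (hI : I.OrdConnected)
    (hne : (interior I).Nonempty) (α β γ : ℝ → ℂ) (f : ℝ → EuclideanSpace ℂ (Fin n))
    (hα : ContinuousOn α I) (hβ : ContinuousOn β I) (hγ : ContinuousOn γ I)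
    (hf : ContinuousOn f I) (hα0 : ∀ t ∈ I, α t ≠ 0)
    (ρ ρ' : ℝ → ℂ) (hρc : ContinuousOn ρ' I)
    (hρd : ∀ t ∈ I, HasDerivWithinAt ρ (ρ' t) I t)
    (hRic : ∀ t ∈ I, α t * (ρ' t + ρ t ^ 2) + β t * ρ t + γ t = 0)
    (hint₁ : ∀ t ∈ I, IntegrableOn
      (fun s => Real.exp (∫ μ in t..s, (ρ μ + β μ / α μ).re) / ‖α s‖) (Ioi t ∩ I))
    (hint₃ : ∀ t ∈ I, IntegrableOn
      (fun s => Real.exp (∫ μ in s..t, (ρ μ).re)) (Iic t ∩ I))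
    {M₁ M₃ : ℝ}
    (hM₁ : ∀ t ∈ I,
      ∫ s in Ioi t ∩ I, Real.exp (∫ μ in t..s, (ρ μ + β μ / α μ).re) / ‖α s‖ ≤ M₁)
    (hM₃ : ∀ t ∈ I, ∫ s in Iic t ∩ I, Real.exp (∫ μ in s..t, (ρ μ).re) ≤ M₃) :
    IsUlamConstant n I α β γ f
      (sSup ((fun t => ∫ s in Iic t ∩ I,
        (∫ μ in Ioi s ∩ I, Real.exp (∫ ν in s..μ, (ρ ν + β ν / α ν).re) / ‖α μ‖) *
          Real.exp (∫ μ in s..t, (ρ μ).re)) '' I)) := by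
  set p : ℝ → ℂ := fun s => ρ s + β s / α s with hp
  have hρ : ContinuousOn ρ I := fun t ht => (hρd t ht).continuousWithinAt
  have hpc : ContinuousOn p I := hρ.add (hβ.div hα hα0)
  have hKc := continuousOn_setIntegral_exp_div_norm hI hpc hα hα0 hint₁
  set K : ℝ → ℝ := fun t =>
    ∫ s in Ioi t ∩ I, Real.exp (∫ μ in t..s, (p μ).re) / ‖α s‖ with hK
  have hmeas₁ : ∀ t, MeasurableSet (Ioi t ∩ I) := fun t => measurableSet_Ioi.inter hI.measurableSet
  have hmeas₃ : ∀ t, MeasurableSet (Iic t ∩ I) := fun t => measurableSet_Iic.inter hI.measurableSet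
  have hK0 : ∀ t, 0 ≤ K t := fun t => integral_nonneg fun s => by positivity
  have hM₁0 : 0 ≤ M₁ := by
    obtain ⟨c, hc⟩ := hne
    exact (hK0 c).trans (hM₁ c (interior_subset hc))
  set G : ℝ → ℝ := fun t => ∫ s in Iic t ∩ I, K s * Real.exp (∫ μ in s..t, (ρ μ).re) with hG
  have hGint : ∀ t ∈ I, IntegrableOn
      (fun s => K s * Real.exp (∫ μ in s..t, (ρ μ).re)) (Iic t ∩ I) := fun t ht => by
    refine (hint₃ t ht).bdd_mul (c := M₁)
      ((hKc.mono inter_subset_right).aestronglyMeasurable (hmeas₃ t)) ?_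
    filter_upwards [ae_restrict_mem (hmeas₃ t)] with s hs
    rw [Real.norm_of_nonneg (hK0 s)]
    exact hM₁ s hs.2
  have hGle : ∀ t ∈ I, G t ≤ M₁ * M₃ := fun t ht => by
    refine (setIntegral_mono_on (hGint t ht) ((hint₃ t ht).const_mul M₁) (hmeas₃ t)
      fun s hs => mul_le_mul_of_nonneg_right (hM₁ s hs.2) (Real.exp_pos _).le).trans ?_
    rw [integral_const_mul]
    exact mul_le_mul_of_nonneg_left (hM₃ t ht) hM₁0
  have hbdd : BddAbove (G '' I) := ⟨M₁ * M₃, by rintro _ ⟨t, ht, rfl⟩; exact hGle t ht⟩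
  have hGL : ∀ t ∈ I, G t ≤ sSup (G '' I) := fun t ht => le_csSup hbdd ⟨t, ht, rfl⟩
  have hKpos : ∀ t ∈ interior I, 0 < K t := fun t ht => by
    refine (setIntegral_pos_iff_support_of_nonneg_ae (Filter.Eventually.of_forall fun s => by
      positivity) (hint₁ t (interior_subset ht))).2
      ((volume_Ioi_inter_interior_pos ht).trans_le (measure_mono fun s hs => ?_))
    have hsI := interior_subset hs.2
    exact ⟨(div_pos (Real.exp_pos _) (norm_pos_iff.2 (hα0 s hsI))).ne', hs.1, hsI⟩
  have hGpos : ∀ t ∈ interior I, 0 < G t := fun t ht => by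
    refine (setIntegral_pos_iff_support_of_nonneg_ae (Filter.Eventually.of_forall fun s =>
      mul_nonneg (hK0 s) (Real.exp_pos _).le) (hGint t (interior_subset ht))).2
      ((volume_Iic_inter_interior_pos ht).trans_le (measure_mono fun s hs => ?_))
    exact ⟨(mul_pos (hKpos s hs.2) (Real.exp_pos _)).ne', hs.1, interior_subset hs.2⟩
  refine ⟨?_, fun ε hε ξ ξd ξdd hξ hξd hξdd hres => ?_⟩
  · obtain ⟨c, hc⟩ := hne
    exact (hGpos c hc).trans_le (hGL c (interior_subset hc))
  have hξc : ContinuousOn ξ I := fun t ht => (hξ t ht).continuousWithinAt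
  have hξdc : ContinuousOn ξd I := fun t ht => (hξd t ht).continuousWithinAt
  set g : ℝ → EuclideanSpace ℂ (Fin n) := fun t =>
    (α t)⁻¹ • (α t • ξdd t + β t • ξd t + γ t • ξ t - f t) with hg
  have hgc : ContinuousOn g I := (hα.inv₀ hα0).smul
    ((((hα.smul hξdd).add (hβ.smul hξdc)).add (hγ.smul hξc)).sub hf)
  have hgle : ∀ t ∈ I, ‖g t‖ ≤ ε / ‖α t‖ := fun t ht => by
    rw [hg, norm_smul, norm_inv, div_eq_inv_mul]
    exact mul_le_mul_of_nonneg_left (hres t ht) (by positivity)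
  have hzker : ∀ t ∈ I, ∀ s ∈ I, ‖Complex.exp (∫ μ in t..s, p μ) • g s‖ ≤
      ε * (Real.exp (∫ μ in t..s, (p μ).re) / ‖α s‖) := fun t ht s hs => by
    rw [norm_smul, hpc.norm_cexp_intervalIntegral hI ht hs]
    calc _ ≤ Real.exp (∫ μ in t..s, (p μ).re) * (ε / ‖α s‖) :=
          mul_le_mul_of_nonneg_left (hgle s hs) (Real.exp_pos _).le
      _ = _ := by ring
  have hzint : ∀ t ∈ I,
      IntegrableOn (fun s => Complex.exp (∫ μ in t..s, p μ) • g s) (Ioi t ∩ I) := fun t ht => by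
    refine ((hint₁ t ht).const_mul ε).mono'
      ((((hpc.intervalIntegral_right hI ht).cexp.smul hgc).mono
        inter_subset_right).aestronglyMeasurable (hmeas₁ t)) ?_
    filter_upwards [ae_restrict_mem (hmeas₁ t)] with s hs using hzker t ht s hs.2
  set z : ℝ → EuclideanSpace ℂ (Fin n) := fun t =>
    -∫ s in Ioi t ∩ I, Complex.exp (∫ μ in t..s, p μ) • g s with hz
  have hzd : ∀ t ∈ I, HasDerivWithinAt z (-(p t • z t) + g t) I t := fun t ht => by
    refine ((hasDerivWithinAt_setIntegral_exp_smul_Ioi hI hpc hgc hzint ht).fun_neg).congr_deriv ?_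
    rw [hz]
    module
  have hzc : ContinuousOn z I := fun t ht => (hzd t ht).continuousWithinAt
  have hzle : ∀ t ∈ I, ‖z t‖ ≤ ε * K t := fun t ht => by
    rw [hz, norm_neg, hK, ← integral_const_mul]
    refine norm_integral_le_of_norm_le ((hint₁ t ht).const_mul ε) ?_
    filter_upwards [ae_restrict_mem (hmeas₁ t)] with s hs using hzker t ht s hs.2
  have hyker : ∀ t ∈ I, ∀ s ∈ I, ‖Complex.exp (∫ μ in s..t, ρ μ) • z s‖ ≤
      ε * (K s * Real.exp (∫ μ in s..t, (ρ μ).re)) := fun t ht s hs => by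
    rw [norm_smul, hρ.norm_cexp_intervalIntegral hI hs ht]
    calc _ ≤ Real.exp (∫ μ in s..t, (ρ μ).re) * (ε * K s) :=
          mul_le_mul_of_nonneg_left (hzle s hs) (Real.exp_pos _).le
      _ = _ := by ring
  have hyint : ∀ t ∈ I,
      IntegrableOn (fun s => Complex.exp (∫ μ in s..t, ρ μ) • z s) (Iic t ∩ I) := fun t ht => by
    refine ((hGint t ht).const_mul ε).mono'
      ((((hρ.intervalIntegral_left hI ht).cexp.smul hzc).mono
        inter_subset_right).aestronglyMeasurable (hmeas₃ t)) ?_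
    filter_upwards [ae_restrict_mem (hmeas₃ t)] with s hs using hyker t ht s hs.2
  set y : ℝ → EuclideanSpace ℂ (Fin n) := fun t =>
    ∫ s in Iic t ∩ I, Complex.exp (∫ μ in s..t, ρ μ) • z s with hy
  have hyd : ∀ t ∈ I, HasDerivWithinAt y (ρ t • y t + z t) I t := fun t ht =>
    hasDerivWithinAt_setIntegral_exp_smul_Iic hI hρ hzc hyint ht
  have hyc : ContinuousOn y I := fun t ht => (hyd t ht).continuousWithinAt
  have hyle : ∀ t ∈ I, ‖y t‖ ≤ ε * G t := fun t ht => by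
    rw [hy, hG, ← integral_const_mul]
    refine norm_integral_le_of_norm_le ((hGint t ht).const_mul ε) ?_
    filter_upwards [ae_restrict_mem (hmeas₃ t)] with s hs using hyker t ht s hs.2
  refine ⟨fun t => ξ t - y t, fun t => ξd t - (ρ t • y t + z t),
    fun t => ξdd t - (ρ t • (ρ t • y t + z t) + ρ' t • y t + (-(p t • z t) + g t)),
    fun t ht => (hξ t ht).fun_sub (hyd t ht),
    fun t ht => (hξd t ht).fun_sub (((hρd t ht).fun_smul (hyd t ht)).fun_add (hzd t ht)),
    hξdd.sub (((hρ.smul ((hρ.smul hyc).add hzc)).add (hρc.smul hyc)).add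
      ((hpc.smul hzc).neg.add hgc)), fun t ht => ?_, fun t ht => ?_⟩
  · have hαg : α t • g t = α t • ξdd t + β t • ξd t + γ t • ξ t - f t := by
      rw [hg, smul_inv_smul₀ (hα0 t ht)]
    have hαp : α t * p t = α t * ρ t + β t := by
      rw [hp, mul_add, mul_div_cancel₀ _ (hα0 t ht)]
    linear_combination (norm := module) -(hRic t ht) • y t + hαp • z t - hαg
  · rw [sub_sub_cancel, mul_comm]
    exact (hyle t ht).trans (mul_le_mul_of_nonneg_left (hGL t ht) hε.le)

end Ulam

section Endpoints

variable {τ σ : EReal} {I : Set ℝ}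

theorem ae_eq_of_subset_of_diff_subset_singleton {S T : Set ℝ} (hST : S ⊆ T) {a : ℝ}
    (h : T \ S ⊆ {a}) : S =ᵐ[volume] T :=
  hST.eventuallyLE.antisymm (ae_le_set.2 (measure_mono_null h (by simp)))

theorem IooE_ae_eq (hlo : {t : ℝ | τ < (t : EReal) ∧ (t : EReal) < σ} ⊆ I)
    (hup : I ⊆ {t : ℝ | τ ≤ (t : EReal) ∧ (t : EReal) ≤ σ}) {t : ℝ} (ht : t ∈ I) :
    IooE t σ =ᵐ[volume] (Ioi t ∩ I : Set ℝ) := by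
  refine ae_eq_of_subset_of_diff_subset_singleton (a := σ.toReal)
    (fun s hs => ⟨hs.1, hlo ⟨(hup ht).1.trans_lt (EReal.coe_lt_coe_iff.2 hs.1), hs.2⟩⟩) ?_
  rintro s ⟨⟨hts, hsI⟩, hs⟩
  have : (s : EReal) = σ := (hup hsI).2.antisymm (not_lt.1 fun h => hs ⟨hts, h⟩)
  simp [← this]

theorem EIoo_ae_eq (hlo : {t : ℝ | τ < (t : EReal) ∧ (t : EReal) < σ} ⊆ I)
    (hup : I ⊆ {t : ℝ | τ ≤ (t : EReal) ∧ (t : EReal) ≤ σ}) {t : ℝ} (ht : t ∈ I) :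
    EIoo τ t =ᵐ[volume] (Iic t ∩ I : Set ℝ) := by
  have h : EIoo τ t =ᵐ[volume] (Iio t ∩ I : Set ℝ) := by
    refine ae_eq_of_subset_of_diff_subset_singleton (a := τ.toReal)
      (fun s hs => ⟨hs.2, hlo ⟨hs.1, (EReal.coe_lt_coe_iff.2 hs.2).trans_le (hup ht).2⟩⟩) ?_
    rintro s ⟨⟨hst, hsI⟩, hs⟩
    have : (s : EReal) = τ := (not_lt.1 fun h => hs ⟨h, hst⟩).antisymm (hup hsI).1
    simp [← this]
  exact h.trans (Iio_ae_eq_Iic.inter (Filter.EventuallyEq.refl _ _))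

end Endpoints

/-- Theorem 3.1 (ii). -/
theorem ulam_stability_case_ii (n : ℕ) (τ σ : EReal) (hτσ : τ < σ) (I : Set ℝ)
    (hI : I = {t : ℝ | τ < (t : EReal) ∧ (t : EReal) < σ} ∨
          I = {t : ℝ | τ < (t : EReal) ∧ (t : EReal) ≤ σ} ∨
          I = {t : ℝ | τ ≤ (t : EReal) ∧ (t : EReal) < σ} ∨
          I = {t : ℝ | τ ≤ (t : EReal) ∧ (t : EReal) ≤ σ})
    (α β γ : ℝ → ℂ) (f : ℝ → EuclideanSpace ℂ (Fin n))
    (hα : ContinuousOn α I) (hβ : ContinuousOn β I) (hγ : ContinuousOn γ I)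
    (hf : ContinuousOn f I) (hα0 : ∀ t ∈ I, α t ≠ 0)
    (ρ ρ' : ℝ → ℂ) (hρc : ContinuousOn ρ' I)
    (hρd : ∀ t ∈ I, HasDerivWithinAt ρ (ρ' t) I t)
    (hRic : ∀ t ∈ I, α t * (ρ' t + ρ t ^ 2) + β t * ρ t + γ t = 0)
    (hf₁int : ∀ t ∈ I, IntegrableOn
      (fun s => Real.exp (∫ μ in t..s, (ρ μ + β μ / α μ).re) / ‖α s‖) (IooE t σ))
    (hf₃int : ∀ t ∈ I, IntegrableOn
      (fun s => Real.exp (∫ μ in s..t, (ρ μ).re)) (EIoo τ t))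
    (hf₁bdd : BddAbove (f₁ σ α β ρ '' I))
    (hf₃bdd : BddAbove (f₃ τ ρ '' I)) :
    (∃ L, IsUlamConstant n I α β γ f L) ∧
      IsUlamConstant n I α β γ f
        (sSup ((fun t => ∫ s in EIoo τ t,
          (∫ μ in IooE s σ, Real.exp (∫ ν in s..μ, (ρ ν + β ν / α ν).re) / ‖α μ‖) *
            Real.exp (∫ μ in s..t, (ρ μ).re)) '' I)) := by
  have hlo : {t : ℝ | τ < (t : EReal) ∧ (t : EReal) < σ} ⊆ I := by
    rcases hI with rfl | rfl | rfl | rfl <;> intro t ht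
    exacts [ht, ⟨ht.1, ht.2.le⟩, ⟨ht.1.le, ht.2⟩, ⟨ht.1.le, ht.2.le⟩]
  have hup : I ⊆ {t : ℝ | τ ≤ (t : EReal) ∧ (t : EReal) ≤ σ} := by
    rcases hI with rfl | rfl | rfl | rfl <;> intro t ht
    exacts [⟨ht.1.le, ht.2.le⟩, ⟨ht.1.le, ht.2⟩, ⟨ht.1, ht.2.le⟩, ht]
  have hmono : Monotone ((↑) : ℝ → EReal) := fun _ _ h => EReal.coe_le_coe_iff.2 h
  have hord : I.OrdConnected := by
    rcases hI with rfl | rfl | rfl | rfl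
    exacts [ordConnected_Ioo.preimage_mono hmono, ordConnected_Ioc.preimage_mono hmono,
      ordConnected_Ico.preimage_mono hmono, ordConnected_Icc.preimage_mono hmono]
  have hne : (interior I).Nonempty := by
    obtain ⟨c, hτc, hcσ⟩ := EReal.lt_iff_exists_real_btwn.1 hτσ
    exact ⟨c, interior_maximal hlo (isOpen_Ioo.preimage continuous_coe_real_ereal) ⟨hτc, hcσ⟩⟩
  obtain ⟨M₁, hM₁⟩ := hf₁bdd
  obtain ⟨M₃, hM₃⟩ := hf₃bdd
  have hS := fun t (ht : t ∈ I) => IooE_ae_eq hlo hup ht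
  have hT := fun t (ht : t ∈ I) => EIoo_ae_eq hlo hup ht
  have h := isUlamConstant_of_riccati n hord hne α β γ f hα hβ hγ hf hα0 ρ ρ' hρc hρd hRic
    (fun t ht => (hf₁int t ht).congr_set_ae (hS t ht).symm)
    (fun t ht => (hf₃int t ht).congr_set_ae (hT t ht).symm)
    (fun t ht => (setIntegral_congr_set (hS t ht)).symm.trans_le (hM₁ ⟨t, ht, rfl⟩))
    (fun t ht => (setIntegral_congr_set (hT t ht)).symm.trans_le (hM₃ ⟨t, ht, rfl⟩))
  have himage : (fun t => ∫ s in EIoo τ t,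
      (∫ μ in IooE s σ, Real.exp (∫ ν in s..μ, (ρ ν + β ν / α ν).re) / ‖α μ‖) *
        Real.exp (∫ μ in s..t, (ρ μ).re)) '' I =
      (fun t => ∫ s in Iic t ∩ I,
        (∫ μ in Ioi s ∩ I, Real.exp (∫ ν in s..μ, (ρ ν + β ν / α ν).re) / ‖α μ‖) *
          Real.exp (∫ μ in s..t, (ρ μ).re)) '' I := by
    refine image_congr fun t ht => ?_
    rw [setIntegral_congr_set (hT t ht)]
    refine setIntegral_congr_fun (measurableSet_Iic.inter hord.measurableSet) fun s hs => ?_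
    rw [setIntegral_congr_set (hS s hs.2)]
  rw [himage]
  exact ⟨⟨_, h⟩, h⟩
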